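/- arXiv:2208.05888 — 2 statements merged into one kernel-verified Lean document; each statement's English description precedes it below -/
import Mathlib

section
/- Let f : E → ℝ be three times differentiable with M₂ = L_{2,0} < ∞ and M₄ = L_{3,1} < ∞, and suppose 0 < M₂ and 0 < M₄. Then for every q ∈ [2, 4] the constant M_q is finite and satisfies M_q ≤ 3 · (M₂)^{(4 − q)/2} · (M₄)^{(q − 2)/2}. -/
open Set
open scoped ENNReal

/-- The Hölder constant `L_{p,ν}` of the `p`-th derivative of `f`:
`L_{p,ν} = sup_{x ≠ y} ‖∇^p f(x) - ∇^p f(y)‖ / ‖x - y‖^ν`, as an extended nonnegative real. -/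
noncomputable def holderConst {E : Type*} [NormedAddCommGroup E] [InnerProductSpace ℝ E]
    (p : ℕ) (f : E → ℝ) (ν : ℝ) : ℝ≥0∞ :=
  ⨆ (x : E) (y : E) (_ : x ≠ y),
    ENNReal.ofReal (‖iteratedFDeriv ℝ p f x - iteratedFDeriv ℝ p f y‖ / ‖x - y‖ ^ ν)

/-- The family `M_q`, `2 ≤ q ≤ 4`: `M_{2+ν} = L_{2,ν}` for `ν ∈ [0,1)` and
`M_{3+ν} = L_{3,ν}` for `ν ∈ [0,1]`. -/
noncomputable def Mconst {E : Type*} [NormedAddCommGroup E] [InnerProductSpace ℝ E]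
    (f : E → ℝ) (q : ℝ) : ℝ≥0∞ :=
  if q < 3 then holderConst 2 f (q - 2) else holderConst 3 f (q - 3)

lemma aux_interp {d a b r ν : ℝ} (hd : 0 ≤ d) (ha : d ≤ a) (hb : 0 ≤ b) (hr : 0 < r)
    (hbr : d ≤ b * r) (h0 : 0 ≤ ν) (h1 : ν ≤ 1) : d / r ^ ν ≤ a ^ (1 - ν) * b ^ ν := by
  have hrν : 0 < r ^ ν := Real.rpow_pos_of_pos hr _
  rw [div_le_iff₀ hrν]
  calc d = d ^ (1 - ν) * d ^ ν := by
        rw [← Real.rpow_add_of_nonneg hd (by linarith) h0]; simp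
    _ ≤ a ^ (1 - ν) * (b * r) ^ ν := by
        have : 0 ≤ a := hd.trans ha
        have h1' : 0 ≤ 1 - ν := by linarith
        gcongr
    _ = a ^ (1 - ν) * b ^ ν * r ^ ν := by rw [Real.mul_rpow hb hr.le]; ring

lemma aux_bound {E F : Type*} [NormedAddCommGroup E] [NormedSpace ℝ E]
    [NormedAddCommGroup F] [NormedSpace ℝ F] (g : E → F) (hg : Differentiable ℝ g)
    {A B K : ℝ} (hA : 0 < A) (hB : 0 < B) (hK : 0 < K) (hK2 : K ^ 2 = 9 / 4 * (A * B))
    (h2 : ∀ x y, ‖g x - g y‖ ≤ A) (h4 : ∀ x y, ‖fderiv ℝ g x - fderiv ℝ g y‖ ≤ B * ‖x - y‖)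
    (x : E) : ‖fderiv ℝ g x‖ ≤ K := by
  refine ContinuousLinearMap.opNorm_le_bound _ hK.le fun v => ?_
  rcases eq_or_ne v 0 with rfl | hv
  · simp
  have hv' : 0 < ‖v‖ := norm_pos_iff.2 hv
  set r := A / K with hr
  have hr0 : 0 < r := by positivity
  set h := (r / ‖v‖) • v with hh
  have hhn : ‖h‖ = r := by
    rw [hh, norm_smul, Real.norm_of_nonneg (by positivity)]; field_simp
  have key : ‖g (x + h) - g (x - h) - fderiv ℝ g x ((x + h) - (x - h))‖
      ≤ (B * r) * ‖(x + h) - (x - h)‖ := by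
    refine (convex_closedBall x r).norm_image_sub_le_of_norm_hasFDerivWithin_le'
      (f' := fderiv ℝ g) (fun y _ => (hg y).hasFDerivAt.hasFDerivWithinAt) (fun y hy => ?_) ?_ ?_
    · refine (h4 y x).trans ?_
      gcongr
      simpa [dist_eq_norm] using hy
    · simp [dist_eq_norm, hhn]
    · simp [dist_eq_norm, hhn]
  have e : (x + h) - (x - h) = (2 : ℝ) • h := by rw [two_smul]; abel
  rw [e, norm_smul, hhn, map_smul] at key
  have t : ‖(2 : ℝ) • fderiv ℝ g x h‖ ≤ A + B * r * (‖(2 : ℝ)‖ * r) := by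
    have := norm_sub_le (g (x + h) - g (x - h))
      (g (x + h) - g (x - h) - (2 : ℝ) • fderiv ℝ g x h)
    rw [sub_sub_cancel] at this
    linarith [h2 (x + h) (x - h)]
  rw [hh, map_smul, norm_smul, norm_smul, Real.norm_of_nonneg (by positivity : 0 ≤ r / ‖v‖),
    Real.norm_of_nonneg (by norm_num : (0 : ℝ) ≤ 2)] at t
  have hBr : B * r * r = 4 / 9 * A := by
    have : B * r * r = B * A ^ 2 / K ^ 2 := by rw [hr]; field_simp
    rw [this, hK2]; field_simp
  have t2 : r / ‖v‖ * ‖fderiv ℝ g x v‖ ≤ A := by nlinarith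
  have : r / ‖v‖ * ‖fderiv ℝ g x v‖ = A * (‖fderiv ℝ g x v‖ / (K * ‖v‖)) := by
    rw [hr]; field_simp
  rw [this] at t2
  have t3 : ‖fderiv ℝ g x v‖ / (K * ‖v‖) ≤ 1 := by
    by_contra hc
    push Not at hc
    nlinarith
  rwa [div_le_one (by positivity)] at t3

lemma aux_holder {E : Type*} [NormedAddCommGroup E] [InnerProductSpace ℝ E]
    {p : ℕ} {f : E → ℝ} {ν : ℝ} (h : holderConst p f ν ≠ ⊤) {x y : E} (hxy : x ≠ y) :
    ‖iteratedFDeriv ℝ p f x - iteratedFDeriv ℝ p f y‖ / ‖x - y‖ ^ ν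
      ≤ (holderConst p f ν).toReal := by
  rw [← ENNReal.ofReal_le_iff_le_toReal h]
  exact le_iSup_of_le x (le_iSup_of_le y (le_iSup_of_le hxy le_rfl))

lemma aux_main {E : Type*} [NormedAddCommGroup E] [InnerProductSpace ℝ E]
    (f : E → ℝ) (hf : ContDiff ℝ 3 f) {A B K : ℝ} (hA : 0 < A) (hB : 0 < B)
    (hK : 0 < K) (hK2 : K ^ 2 = 9 / 4 * (A * B))
    (h2 : ∀ x y, ‖iteratedFDeriv ℝ 2 f x - iteratedFDeriv ℝ 2 f y‖ ≤ A)
    (h4 : ∀ x y, ‖iteratedFDeriv ℝ 3 f x - iteratedFDeriv ℝ 3 f y‖ ≤ B * ‖x - y‖) :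
    (∀ x y, ‖iteratedFDeriv ℝ 2 f x - iteratedFDeriv ℝ 2 f y‖ ≤ K * ‖x - y‖) ∧
    (∀ x y, ‖iteratedFDeriv ℝ 3 f x - iteratedFDeriv ℝ 3 f y‖ ≤ 2 * K) := by
  have hg : Differentiable ℝ (iteratedFDeriv ℝ 2 f) :=
    hf.differentiable_iteratedFDeriv (by norm_cast)
  have hb := aux_bound (iteratedFDeriv ℝ 2 f) hg hA hB hK hK2 h2 (fun x y => by
    rw [fderiv_iteratedFDeriv]
    simp only [Function.comp_apply]
    refine le_trans (le_of_eq ?_) (h4 x y)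
    rw [← LinearIsometryEquiv.map_sub, LinearIsometryEquiv.norm_map])
  refine ⟨fun x y => ?_, fun x y => ?_⟩
  · exact convex_univ.norm_image_sub_le_of_norm_fderiv_le (𝕜 := ℝ) (fun z _ => hg z)
      (fun z _ => hb z) (mem_univ y) (mem_univ x)
  · have h3 : ∀ z, ‖iteratedFDeriv ℝ 3 f z‖ ≤ K := fun z => by
      rw [← norm_fderiv_iteratedFDeriv]; exact hb z
    linarith [norm_sub_le (iteratedFDeriv ℝ 3 f x) (iteratedFDeriv ℝ 3 f y), h3 x, h3 y]

/-- Let `f` be three times differentiable with `M₂ = L_{2,0} < ∞` and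
`M₄ = L_{3,1} < ∞`, both positive. Then for every `q ∈ [2,4]` the constant `M_q` is finite
and satisfies `M_q ≤ 3 · M₂^{(4-q)/2} · M₄^{(q-2)/2}`. -/
theorem statement_5 {E : Type*} [NormedAddCommGroup E] [InnerProductSpace ℝ E]
    (f : E → ℝ) (hf : ContDiff ℝ 3 f)
    (h2fin : holderConst 2 f 0 ≠ ⊤) (h2pos : 0 < holderConst 2 f 0)
    (h4fin : holderConst 3 f 1 ≠ ⊤) (h4pos : 0 < holderConst 3 f 1) :
    ∀ q ∈ Set.Icc (2 : ℝ) 4,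
      Mconst f q ≠ ⊤ ∧
        Mconst f q ≤
          3 * holderConst 2 f 0 ^ ((4 - q) / 2) * holderConst 3 f 1 ^ ((q - 2) / 2) := by
  intro q hq
  obtain ⟨hq2, hq4⟩ := hq
  obtain ⟨A, hAdef⟩ : ∃ A, A = (holderConst 2 f 0).toReal := ⟨_, rfl⟩
  obtain ⟨B, hBdef⟩ : ∃ B, B = (holderConst 3 f 1).toReal := ⟨_, rfl⟩
  have hA : 0 < A := hAdef ▸ ENNReal.toReal_pos h2pos.ne' h2fin
  have hB : 0 < B := hBdef ▸ ENNReal.toReal_pos h4pos.ne' h4fin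
  have h2 : ∀ x y, ‖iteratedFDeriv ℝ 2 f x - iteratedFDeriv ℝ 2 f y‖ ≤ A := fun x y => by
    rcases eq_or_ne x y with rfl | hxy
    · simpa using hA.le
    · simpa [hAdef] using aux_holder h2fin hxy
  have h4 : ∀ x y, ‖iteratedFDeriv ℝ 3 f x - iteratedFDeriv ℝ 3 f y‖ ≤ B * ‖x - y‖ :=
    fun x y => by
    rcases eq_or_ne x y with rfl | hxy
    · simp
    · have := aux_holder h4fin hxy
      rwa [Real.rpow_one, div_le_iff₀ (norm_pos_iff.2 (sub_ne_zero.2 hxy)), ← hBdef] at this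
  have eA : holderConst 2 f 0 = ENNReal.ofReal A := by rw [hAdef, ENNReal.ofReal_toReal h2fin]
  have eB : holderConst 3 f 1 = ENNReal.ofReal B := by rw [hBdef, ENNReal.ofReal_toReal h4fin]
  have e3 : (3 : ℝ≥0∞) = ENNReal.ofReal 3 := by simp
  obtain ⟨K, hKdef⟩ : ∃ K, K = 3 / 2 * (A ^ (1 / 2 : ℝ) * B ^ (1 / 2 : ℝ)) := ⟨_, rfl⟩
  have hK : 0 < K := by rw [hKdef]; positivity
  have hK2 : K ^ 2 = 9 / 4 * (A * B) := by
    have a1 : (A ^ (1 / 2 : ℝ)) ^ 2 = A := by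
      rw [← Real.sqrt_eq_rpow, Real.sq_sqrt hA.le]
    have b1 : (B ^ (1 / 2 : ℝ)) ^ 2 = B := by
      rw [← Real.sqrt_eq_rpow, Real.sq_sqrt hB.le]
    rw [hKdef, mul_pow, mul_pow, a1, b1]; norm_num
  obtain ⟨k2, k3⟩ := aux_main f hf hA hB hK hK2 h2 h4
  have hle : Mconst f q ≤
      3 * holderConst 2 f 0 ^ ((4 - q) / 2) * holderConst 3 f 1 ^ ((q - 2) / 2) := by
    rw [eA, eB, ENNReal.ofReal_rpow_of_pos hA, ENNReal.ofReal_rpow_of_pos hB, e3,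
      ← ENNReal.ofReal_mul (by norm_num), ← ENNReal.ofReal_mul (by positivity)]
    unfold Mconst
    split_ifs with h
    · refine iSup_le fun x => iSup_le fun y => iSup_le fun hxy => ENNReal.ofReal_le_ofReal ?_
      refine (aux_interp (norm_nonneg _) (h2 x y) hK.le (norm_pos_iff.2 (sub_ne_zero.2 hxy))
        (k2 x y) (by linarith) (by linarith)).trans ?_
      rw [hKdef, Real.mul_rpow (by norm_num) (by positivity),
        Real.mul_rpow (by positivity) (by positivity), ← Real.rpow_mul hA.le,
        ← Real.rpow_mul hB.le]
      have ea : A ^ ((4 - q) / 2) = A ^ (1 - (q - 2)) * A ^ (1 / 2 * (q - 2)) := by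
        rw [← Real.rpow_add hA]; congr 1; ring
      have eb : (q - 2) / 2 = 1 / 2 * (q - 2) := by ring
      have ec : (3 / 2 : ℝ) ^ (q - 2) ≤ 3 := by
        have := Real.rpow_le_rpow_of_exponent_le (by norm_num : (1 : ℝ) ≤ 3 / 2)
          (by linarith : q - 2 ≤ 1)
        rw [Real.rpow_one] at this; linarith
      rw [ea, eb]
      calc _ = (3 / 2 : ℝ) ^ (q - 2) * (A ^ (1 - (q - 2)) * A ^ (1 / 2 * (q - 2)))
              * B ^ (1 / 2 * (q - 2)) := by ring
        _ ≤ _ := by gcongr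
    · push Not at h
      refine iSup_le fun x => iSup_le fun y => iSup_le fun hxy => ENNReal.ofReal_le_ofReal ?_
      refine (aux_interp (norm_nonneg _) (k3 x y) hB.le (norm_pos_iff.2 (sub_ne_zero.2 hxy))
        (h4 x y) (by linarith) (by linarith)).trans ?_
      have e2K : 2 * K = 3 * (A ^ (1 / 2 : ℝ) * B ^ (1 / 2 : ℝ)) := by rw [hKdef]; ring
      rw [e2K, Real.mul_rpow (by norm_num) (by positivity),
        Real.mul_rpow (by positivity) (by positivity), ← Real.rpow_mul hA.le,
        ← Real.rpow_mul hB.le]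
      have eb : B ^ ((q - 2) / 2) = B ^ (1 / 2 * (1 - (q - 3))) * B ^ (q - 3) := by
        rw [← Real.rpow_add hB]; congr 1; ring
      have ea : (4 - q) / 2 = 1 / 2 * (1 - (q - 3)) := by ring
      have ec : (3 : ℝ) ^ (1 - (q - 3)) ≤ 3 := by
        have := Real.rpow_le_rpow_of_exponent_le (by norm_num : (1 : ℝ) ≤ 3)
          (by linarith : 1 - (q - 3) ≤ 1)
        rwa [Real.rpow_one] at this
      rw [ea, eb]
      calc _ = (3 : ℝ) ^ (1 - (q - 3)) * A ^ (1 / 2 * (1 - (q - 3)))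
              * (B ^ (1 / 2 * (1 - (q - 3))) * B ^ (q - 3)) := by ring
        _ ≤ _ := by gcongr
  refine ⟨ne_top_of_le_ne_top ?_ hle, hle⟩
  rw [eA, eB, ENNReal.ofReal_rpow_of_pos hA, ENNReal.ofReal_rpow_of_pos hB, e3,
      ← ENNReal.ofReal_mul (by norm_num), ← ENNReal.ofReal_mul (by positivity)]
  exact ENNReal.ofReal_ne_top
end

section
/- Let f be convex and three times differentiable with third derivative Hölder continuous of degree ν ∈ [0, 1] and constant L_{3,ν} < ∞. Let T be a regularized Newton step from x ∈ dom ψ with parameter λ > 0 and r := ‖T − x‖. Then for any s ∈ ∂ψ(x), ‖∇³f(x)[T − x]²‖ ≤ 2 · (L_{3,ν} r²/(1 + ν))^{1/(1+ν)} · (‖∇f(x) + s‖²/(4λ))^{ν/(1+ν)}, where ∇³f(x)[h]² denotes the linear form u ↦ ∇³f(x)[h, h, u] and ‖·‖ its dual norm. -/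
open Set
open scoped RealInnerProductSpace

/-- `v` is a subgradient of `ψ` at `x`. -/
def IsSubgradAt {E : Type*} [NormedAddCommGroup E] [InnerProductSpace ℝ E]
    (ψ : E → ℝ) (v x : E) : Prop :=
  ∀ y, ψ x + ⟪v, y - x⟫ ≤ ψ y

open Filter Topology

lemma aux_symm2 {E F : Type*} [NormedAddCommGroup E] [InnerProductSpace ℝ E]
    [NormedAddCommGroup F] [NormedSpace ℝ F]
    (f : E → F) (hf : ContDiff ℝ 2 f) (y a b : E) :
    iteratedFDeriv ℝ 2 f y ![a, b] = iteratedFDeriv ℝ 2 f y ![b, a] := by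
  rw [iteratedFDeriv_two_apply, iteratedFDeriv_two_apply]
  have : IsSymmSndFDerivAt ℝ f y := hf.contDiffAt.isSymmSndFDerivAt (by simp)
  exact this.eq a b

lemma aux_D {E : Type*} [NormedAddCommGroup E] [InnerProductSpace ℝ E]
    (f : E → ℝ) (hf : ContDiff ℝ 3 f) (y a b c : E) :
    HasFDerivAt (fun y => iteratedFDeriv ℝ 2 f y ![b, c])
      ((ContinuousMultilinearMap.apply ℝ (fun _ : Fin 2 => E) ℝ ![b, c]).comp
        (fderiv ℝ (iteratedFDeriv ℝ 2 f) y)) y := by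
  have h1 : DifferentiableAt ℝ (iteratedFDeriv ℝ 2 f) y :=
    (hf.differentiable_iteratedFDeriv (m := 2) (by norm_num)).differentiableAt
  exact (ContinuousMultilinearMap.apply ℝ (fun _ : Fin 2 => E) ℝ ![b, c]).hasFDerivAt.comp y
    h1.hasFDerivAt

lemma aux_D3 {E : Type*} [NormedAddCommGroup E] [InnerProductSpace ℝ E]
    (f : E → ℝ) (y a b c : E) :
    iteratedFDeriv ℝ 3 f y ![a, b, c] = (fderiv ℝ (iteratedFDeriv ℝ 2 f) y) a ![b, c] := by
  rw [iteratedFDeriv_succ_apply_left]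
  rfl

lemma aux_symm3 {E : Type*} [NormedAddCommGroup E] [InnerProductSpace ℝ E]
    (f : E → ℝ) (hf : ContDiff ℝ 3 f) (y h u : E) :
    iteratedFDeriv ℝ 3 f y ![h, h, u] = iteratedFDeriv ℝ 3 f y ![u, h, h] := by
  have e1 : iteratedFDeriv ℝ 3 f y ![h, h, u] = iteratedFDeriv ℝ 3 f y ![h, u, h] := by
    rw [aux_D3, aux_D3]
    have A := aux_D f hf y h h u
    have B := aux_D f hf y h u h
    have : (fun y => iteratedFDeriv ℝ 2 f y ![h, u]) = fun y => iteratedFDeriv ℝ 2 f y ![u, h] := by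
      funext z
      exact aux_symm2 f (hf.of_le (by norm_num)) z h u
    rw [this] at A
    have := congrArg (fun l => l h) (A.unique B)
    simpa using this
  rw [e1, iteratedFDeriv_succ_apply_right (m := ![h, u, h]),
    iteratedFDeriv_succ_apply_right (m := ![u, h, h])]
  have hd : ContDiff ℝ 2 (fderiv ℝ f) := hf.fderiv_right (by norm_num)
  have i1 : Fin.init ![h, u, h] = ![h, u] := by
    ext i; fin_cases i <;> rfl
  have i2 : Fin.init ![u, h, h] = ![u, h] := by
    ext i; fin_cases i <;> rfl
  rw [i1, i2, aux_symm2 _ hd]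
  rfl

lemma aux_taylor {E : Type*} [NormedAddCommGroup E] [InnerProductSpace ℝ E]
    (f : E → ℝ) (hf3 : ContDiff ℝ 3 f) (ν L : ℝ) (hν : 0 ≤ ν) (hL : 0 ≤ L)
    (hHolder : ∀ x y : E,
      ‖iteratedFDeriv ℝ 3 f x - iteratedFDeriv ℝ 3 f y‖ ≤ L * ‖x - y‖ ^ ν) (x h u : E) :
    iteratedFDeriv ℝ 2 f (x + u) ![h, h] ≤ iteratedFDeriv ℝ 2 f x ![h, h]
      + iteratedFDeriv ℝ 3 f x ![u, h, h] + L * ‖h‖ ^ 2 / (1 + ν) * ‖u‖ ^ (1 + ν) := by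
  set C : ℝ := L * ‖h‖ ^ 2 * ‖u‖ ^ (1 + ν) with hC
  have hd : ∀ t : ℝ, HasDerivAt (fun t : ℝ => iteratedFDeriv ℝ 2 f (x + t • u) ![h, h])
      (iteratedFDeriv ℝ 3 f (x + t • u) ![u, h, h]) t := by
    intro t
    have hl : HasDerivAt (fun t : ℝ => x + t • u) u t := by
      simpa using ((hasDerivAt_id t).smul_const u).const_add x
    have := (aux_D f hf3 (x + t • u) h h h).comp_hasDerivAt t hl
    rw [aux_D3]
    exact this
  have hr : ∀ t : ℝ, HasDerivAt (fun t : ℝ => t ^ (1 + ν)) ((1 + ν) * t ^ ν) t := by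
    intro t
    have := Real.hasDerivAt_rpow_const (x := t) (p := 1 + ν) (Or.inr (by linarith))
    simpa using this
  set G : ℝ → ℝ := fun t => t * iteratedFDeriv ℝ 3 f x ![u, h, h] + C / (1 + ν) * t ^ (1 + ν)
    - iteratedFDeriv ℝ 2 f (x + t • u) ![h, h] with hG
  have hGd : ∀ t : ℝ, HasDerivAt G (1 * iteratedFDeriv ℝ 3 f x ![u, h, h]
      + C / (1 + ν) * ((1 + ν) * t ^ ν) - iteratedFDeriv ℝ 3 f (x + t • u) ![u, h, h]) t := by
    intro t
    exact (((hasDerivAt_id t).mul_const _).add ((hr t).const_mul _)).sub (hd t)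
  have hmono : MonotoneOn G (Icc 0 1) := by
    apply monotoneOn_of_deriv_nonneg (convex_Icc 0 1)
    · exact fun t _ => (hGd t).continuousAt.continuousWithinAt
    · exact fun t _ => (hGd t).differentiableAt.differentiableWithinAt
    · intro t ht
      rw [interior_Icc] at ht
      rw [(hGd t).deriv]
      have h1 : iteratedFDeriv ℝ 3 f (x + t • u) ![u, h, h] - iteratedFDeriv ℝ 3 f x ![u, h, h]
          ≤ C * t ^ ν := by
        rw [← ContinuousMultilinearMap.sub_apply]
        refine (le_abs_self _).trans ?_
        rw [← Real.norm_eq_abs]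
        refine (ContinuousMultilinearMap.le_opNorm _ _).trans ?_
        have h2 := hHolder (x + t • u) x
        rw [add_sub_cancel_left, norm_smul, Real.norm_eq_abs, abs_of_pos ht.1,
          Real.mul_rpow ht.1.le (norm_nonneg _)] at h2
        have h3 : (∏ i, ‖(![u, h, h] : Fin 3 → E) i‖) = ‖u‖ * ‖h‖ ^ 2 := by
          rw [Fin.prod_univ_three]; simp; ring
        rw [h3]
        refine (mul_le_mul_of_nonneg_right h2 (by positivity)).trans (le_of_eq ?_)
        rw [hC, add_comm 1 ν, Real.rpow_add_one' (norm_nonneg _) (by linarith)]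
        ring
      have h4 : C / (1 + ν) * ((1 + ν) * t ^ ν) = C * t ^ ν := by
        field_simp
      rw [h4]; linarith
  have := hmono (left_mem_Icc.2 zero_le_one) (right_mem_Icc.2 zero_le_one) zero_le_one
  simp only [hG, zero_mul, zero_smul, add_zero, one_mul, one_smul, Real.one_rpow, mul_one] at this
  rw [Real.zero_rpow (by linarith)] at this
  have h5 : C / (1 + ν) = L * ‖h‖ ^ 2 / (1 + ν) * ‖u‖ ^ (1 + ν) := by rw [hC]; ring
  rw [h5] at this
  linarith

lemma aux_iter2 {E : Type*} [NormedAddCommGroup E] [InnerProductSpace ℝ E] [CompleteSpace E]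
    (f : E → ℝ) (g : E → E) (hg : ∀ y, HasGradientAt f (g y) y)
    (hess : E → E →L[ℝ] E) (hhess : ∀ y, HasFDerivAt g (hess y) y) (y h : E) :
    iteratedFDeriv ℝ 2 f y ![h, h] = ⟪hess y h, h⟫ := by
  rw [iteratedFDeriv_two_apply]
  have h1 : fderiv ℝ f = fun y => innerSL ℝ (g y) := by
    funext z
    exact (hg z).hasFDerivAt.fderiv
  have h2 : HasFDerivAt (fderiv ℝ f) ((innerSL ℝ).comp (hess y)) y := by
    rw [h1]
    exact (innerSL ℝ).hasFDerivAt.comp y (hhess y)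
  rw [h2.fderiv]
  simp

lemma aux_nonneg {E : Type*} [NormedAddCommGroup E] [InnerProductSpace ℝ E] [CompleteSpace E]
    (f : E → ℝ) (hf : ConvexOn ℝ Set.univ f) (g : E → E) (hg : ∀ y, HasGradientAt f (g y) y)
    (hess : E → E →L[ℝ] E) (hhess : ∀ y, HasFDerivAt g (hess y) y) (y h : E) :
    0 ≤ ⟪hess y h, h⟫ := by
  have hl : ∀ t : ℝ, HasDerivAt (fun t : ℝ => y + t • h) h t := by
    intro t
    simpa using ((hasDerivAt_id t).smul_const h).const_add y
  have hd : ∀ t : ℝ, HasDerivAt (fun t : ℝ => f (y + t • h)) ⟪g (y + t • h), h⟫ t := by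
    intro t
    have := (hg (y + t • h)).hasFDerivAt.comp_hasDerivAt t (hl t)
    exact this
  have hc : ConvexOn ℝ Set.univ (fun t : ℝ => f (y + t • h)) := by
    have := hf.comp_affineMap (AffineMap.lineMap (k := ℝ) y (y + h))
    rw [preimage_univ] at this
    have e : (f ∘ (AffineMap.lineMap (k := ℝ) y (y + h))) = fun t : ℝ => f (y + t • h) := by
      funext t
      simp [AffineMap.lineMap_apply, add_comm]
    rw [e] at this
    exact this
  have hm := hc.monotoneOn_deriv (fun t _ => (hd t).differentiableAt)
  have he : deriv (fun t : ℝ => f (y + t • h)) = fun t => ⟪g (y + t • h), h⟫ := by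
    funext t
    exact (hd t).deriv
  rw [he, monotoneOn_univ] at hm
  have h0 := hm.deriv_nonneg (x := 0)
  have hg0 : HasDerivAt (fun t : ℝ => g (y + t • h)) (hess y h) 0 := by
    have h1 := hhess (y + (0 : ℝ) • h)
    have := h1.comp_hasDerivAt (0 : ℝ) (hl 0)
    rw [zero_smul, add_zero] at this
    exact this
  have h3 := hg0.inner ℝ (hasDerivAt_const (0 : ℝ) h)
  rw [h3.deriv] at h0
  simpa using h0

lemma aux_scalar (ν A B D : ℝ) (hν : 0 ≤ ν) (hA : 0 ≤ A) (hB : 0 ≤ B)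
    (hD : ∀ τ : ℝ, 0 < τ → τ * D ≤ A + B * τ ^ (1 + ν)) :
    D ≤ 2 * B ^ ((1 : ℝ) / (1 + ν)) * A ^ (ν / (1 + ν)) := by
  have key : ∀ ε : ℝ, 0 < ε →
      D ≤ 2 * (B + ε) ^ ((1 : ℝ) / (1 + ν)) * (A + ε) ^ (ν / (1 + ν)) := by
    intro ε hε
    have hA' : 0 < A + ε := by linarith
    have hB' : 0 < B + ε := by linarith
    set a := A + ε with ha
    set b := B + ε with hb
    set τ : ℝ := (a / b) ^ ((1 : ℝ) / (1 + ν)) with hτ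
    have hτ0 : 0 < τ := by positivity
    have h1 : τ ^ (1 + ν) = a / b := by
      rw [hτ, ← Real.rpow_mul (by positivity), one_div, inv_mul_cancel₀ (by linarith),
        Real.rpow_one]
    have h2 := hD τ hτ0
    have h3 : A + B * τ ^ (1 + ν) ≤ 2 * a := by
      have : b * τ ^ (1 + ν) = a := by rw [h1]; field_simp
      have h5 : B * τ ^ (1 + ν) ≤ b * τ ^ (1 + ν) :=
        mul_le_mul_of_nonneg_right (by linarith) (by positivity)
      linarith
    have h4 : τ * (2 * b ^ ((1 : ℝ) / (1 + ν)) * a ^ (ν / (1 + ν))) = 2 * a := by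
      have e : a ^ ((1 : ℝ) / (1 + ν)) * a ^ (ν / (1 + ν)) = a := by
        rw [← Real.rpow_add hA', ← add_div, div_self (by linarith), Real.rpow_one]
      rw [hτ, Real.div_rpow hA'.le hB'.le]
      have : b ^ ((1 : ℝ) / (1 + ν)) ≠ 0 := by positivity
      calc _ = 2 * (a ^ ((1 : ℝ) / (1 + ν)) * a ^ (ν / (1 + ν))) := by field_simp
        _ = _ := by rw [e]
    refine le_of_mul_le_mul_left ?_ hτ0
    rw [h4]; linarith
  have hc : ∀ c p : ℝ, 0 ≤ p → Tendsto (fun ε : ℝ => (c + ε) ^ p) (𝓝[>] 0) (𝓝 (c ^ p)) := by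
    intro c p hp
    have h1 : Continuous (fun ε : ℝ => (c + ε) ^ p) :=
      (continuous_const.add continuous_id).rpow_const (fun _ => Or.inr hp)
    have := (h1.tendsto 0).mono_left (nhdsWithin_le_nhds (s := Ioi 0))
    simpa using this
  have hlim := ((hc B (1 / (1 + ν)) (by positivity)).const_mul 2).mul
    (hc A (ν / (1 + ν)) (by positivity))
  refine ge_of_tendsto hlim ?_
  filter_upwards [self_mem_nhdsWithin] with ε hε
  exact key ε hε


/-- Let `f` be convex and three times differentiable with third derivative
Hölder continuous of degree `ν ∈ [0,1]` and constant `L = L_{3,ν} < ∞`. Let `T` be a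
regularized Newton step from `x` with parameter `λ > 0`, i.e.
`ψ'(T) := -∇f(x) - ∇²f(x)(T-x) - λ(T-x) ∈ ∂ψ(T)`, and `r := ‖T - x‖`. Then for any
`s ∈ ∂ψ(x)`,
`‖∇³f(x)[T-x]²‖ ≤ 2·(L r²/(1+ν))^{1/(1+ν)} · (‖∇f(x)+s‖²/(4λ))^{ν/(1+ν)}`,
where `∇³f(x)[h]²` is the linear form `u ↦ ∇³f(x)[h,h,u]` with its dual norm. -/
theorem statement_8 {E : Type*} [NormedAddCommGroup E] [InnerProductSpace ℝ E] [CompleteSpace E]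
    (f ψ : E → ℝ) (hf : ConvexOn ℝ Set.univ f) (hψ : ConvexOn ℝ Set.univ ψ)
    (hf3 : ContDiff ℝ 3 f)
    (g : E → E) (hg : ∀ y, HasGradientAt f (g y) y)
    (hess : E → E →L[ℝ] E) (hhess : ∀ y, HasFDerivAt g (hess y) y)
    (ν L : ℝ) (hν : ν ∈ Set.Icc (0 : ℝ) 1) (hL : 0 ≤ L)
    (hHolder : ∀ x y : E,
      ‖iteratedFDeriv ℝ 3 f x - iteratedFDeriv ℝ 3 f y‖ ≤ L * ‖x - y‖ ^ ν)
    (x : E) (lam : ℝ) (hlam : 0 < lam)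
    (T : E) (hT : IsSubgradAt ψ (-(g x) - hess x (T - x) - lam • (T - x)) T)
    (s : E) (hs : IsSubgradAt ψ s x) :
    ‖(iteratedFDeriv ℝ 3 f x).toContinuousLinearMap (fun _ => T - x) 2‖ ≤
      2 * (L * ‖T - x‖ ^ 2 / (1 + ν)) ^ ((1 : ℝ) / (1 + ν)) *
        (‖g x + s‖ ^ 2 / (4 * lam)) ^ (ν / (1 + ν)) := by
  obtain ⟨hν0, hν1⟩ := hν
  have hA : ⟪hess x (T - x), T - x⟫ ≤ ‖g x + s‖ ^ 2 / (4 * lam) := by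
    have h1 := hT x
    have h2 := hs T
    have e : x - T = -(T - x) := by abel
    rw [e] at h1
    set h := T - x with hh
    have h3 : ⟪g x + s, h⟫ + ⟪hess x h, h⟫ + lam * ‖h‖ ^ 2 ≤ 0 := by
      simp only [inner_neg_right, inner_sub_left, inner_neg_left, real_inner_smul_left,
        real_inner_self_eq_norm_sq] at h1
      rw [inner_add_left]
      linarith
    have h4 := abs_real_inner_le_norm (g x + s) h
    have h5 := neg_le_of_abs_le h4
    rw [le_div_iff₀ (by positivity)]
    nlinarith [sq_nonneg (‖g x + s‖ - 2 * lam * ‖h‖)]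
  set h := T - x with hh
  have hR : 0 ≤ 2 * (L * ‖h‖ ^ 2 / (1 + ν)) ^ ((1 : ℝ) / (1 + ν)) *
        (‖g x + s‖ ^ 2 / (4 * lam)) ^ (ν / (1 + ν)) := by positivity
  have hupd : ∀ u, (iteratedFDeriv ℝ 3 f x).toContinuousLinearMap (fun _ => h) 2 u
      = iteratedFDeriv ℝ 3 f x ![u, h, h] := by
    intro u
    rw [← aux_symm3 f hf3]
    have : Function.update (fun _ : Fin 3 => h) 2 u = ![h, h, u] := by
      ext i; fin_cases i <;> rfl
    rw [← this]
    rfl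
  set Φ := (iteratedFDeriv ℝ 3 f x).toContinuousLinearMap (fun _ => h) 2 with hΦ
  have hunit : ∀ u : E, ‖u‖ = 1 → Φ u ≤ 2 * (L * ‖h‖ ^ 2 / (1 + ν)) ^ ((1 : ℝ) / (1 + ν)) *
        (‖g x + s‖ ^ 2 / (4 * lam)) ^ (ν / (1 + ν)) := by
    intro u hu
    apply aux_scalar ν _ _ _ hν0 (by positivity) (by positivity)
    intro τ hτ
    have h1 := aux_taylor f hf3 ν L hν0 hL hHolder x h (-(τ • u))
    rw [aux_iter2 f g hg hess hhess, aux_iter2 f g hg hess hhess, ← hupd, map_neg, map_smul,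
      norm_neg, norm_smul, hu, mul_one, Real.norm_eq_abs, abs_of_pos hτ, smul_eq_mul] at h1
    have h2 := aux_nonneg f hf g hg hess hhess (x + -(τ • u)) h
    linarith
  refine ContinuousLinearMap.opNorm_le_bound _ hR ?_
  intro u
  by_cases hu : u = 0
  · simp [hu]
  have hn : 0 < ‖u‖ := norm_pos_iff.2 hu
  have hv : ‖(‖u‖⁻¹ • u)‖ = 1 := by
    rw [norm_smul, norm_inv, norm_norm, inv_mul_cancel₀ hn.ne']
  have h1 := hunit _ hv
  have h2 := hunit (-(‖u‖⁻¹ • u)) (by rw [norm_neg, hv])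
  rw [map_neg] at h2
  have h3 : Φ u = ‖u‖ * Φ (‖u‖⁻¹ • u) := by
    rw [map_smul, smul_eq_mul, mul_inv_cancel_left₀ hn.ne']
  rw [h3, norm_mul, norm_norm, mul_comm, Real.norm_eq_abs]
  exact mul_le_mul_of_nonneg_right (abs_le.2 ⟨by linarith, h1⟩) hn.le
end
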